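/- arXiv:1307.7572 — 2 statements merged into one kernel-verified Lean document; each statement's English description precedes it below -/
import Mathlib

section
/- The 𝔽-algebra U_q^∨ has a presentation by generators x, y⁻¹, z and relations (q y⁻¹ x − q⁻¹ x y⁻¹)/(q − q⁻¹) = y⁻², (q z y⁻¹ − q⁻¹ y⁻¹ z)/(q − q⁻¹) = y⁻², (q z x − q⁻¹ x z)/(q − q⁻¹) = 1. Precisely, the 𝔽-algebra homomorphism ι from the abstract algebra Ū_q (with generators x, ȳ, z and relations (q ȳ x − q⁻¹ x ȳ)/(q − q⁻¹) = ȳ², (q z ȳ − q⁻¹ ȳ z)/(q − q⁻¹) = ȳ², (q z x − q⁻¹ x z)/(q − q⁻¹) = 1) to U_q(𝔰𝔩₂) sending x ↦ x, ȳ ↦ y⁻¹, z ↦ z is an isomorphism of Ū_q onto U_q^∨. -/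
namespace Paper


/-- Generators for the equitable presentation of `U_q(sl2)`: `x`, `y`, `y⁻¹`, `z`. -/
inductive EqGen : Type
  | x | y | y' | z

/-- The defining relations of the equitable presentation of `U_q(sl2)`. -/
inductive EqRel (F : Type*) [Field F] (q : F) :
    FreeAlgebra F EqGen → FreeAlgebra F EqGen → Prop
  | yy' : EqRel F q (FreeAlgebra.ι F EqGen.y * FreeAlgebra.ι F EqGen.y') 1
  | y'y : EqRel F q (FreeAlgebra.ι F EqGen.y' * FreeAlgebra.ι F EqGen.y) 1
  | xy : EqRel F q
      (q • (FreeAlgebra.ι F EqGen.x * FreeAlgebra.ι F EqGen.y)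
        - q⁻¹ • (FreeAlgebra.ι F EqGen.y * FreeAlgebra.ι F EqGen.x))
      ((q - q⁻¹) • (1 : FreeAlgebra F EqGen))
  | yz : EqRel F q
      (q • (FreeAlgebra.ι F EqGen.y * FreeAlgebra.ι F EqGen.z)
        - q⁻¹ • (FreeAlgebra.ι F EqGen.z * FreeAlgebra.ι F EqGen.y))
      ((q - q⁻¹) • (1 : FreeAlgebra F EqGen))
  | zx : EqRel F q
      (q • (FreeAlgebra.ι F EqGen.z * FreeAlgebra.ι F EqGen.x)
        - q⁻¹ • (FreeAlgebra.ι F EqGen.x * FreeAlgebra.ι F EqGen.z))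
      ((q - q⁻¹) • (1 : FreeAlgebra F EqGen))

/-- `U_q(sl2)` in its equitable presentation. -/
abbrev Usl2 (F : Type*) [Field F] (q : F) := RingQuot (EqRel F q)

noncomputable def ux (F : Type*) [Field F] (q : F) : Usl2 F q :=
  RingQuot.mkAlgHom F (EqRel F q) (FreeAlgebra.ι F EqGen.x)

noncomputable def uy (F : Type*) [Field F] (q : F) : Usl2 F q :=
  RingQuot.mkAlgHom F (EqRel F q) (FreeAlgebra.ι F EqGen.y)

noncomputable def uy' (F : Type*) [Field F] (q : F) : Usl2 F q :=
  RingQuot.mkAlgHom F (EqRel F q) (FreeAlgebra.ι F EqGen.y')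

noncomputable def uz (F : Type*) [Field F] (q : F) : Usl2 F q :=
  RingQuot.mkAlgHom F (EqRel F q) (FreeAlgebra.ι F EqGen.z)

/-- `X = a⁻²x + (1 − a⁻²)y⁻¹`. -/
noncomputable def uX (F : Type*) [Field F] (q a : F) : Usl2 F q :=
  (a ^ 2)⁻¹ • ux F q + (1 - (a ^ 2)⁻¹) • uy' F q

/-- `Z = a²z + (1 − a²)y⁻¹`. -/
noncomputable def uZ (F : Type*) [Field F] (q a : F) : Usl2 F q :=
  a ^ 2 • uz F q + (1 - a ^ 2) • uy' F q

/-- `A = a⁻¹x + az`. -/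
noncomputable def uA (F : Type*) [Field F] (q a : F) : Usl2 F q :=
  a⁻¹ • ux F q + a • uz F q

/-- `U_q^∨`, the subalgebra of `U_q(sl2)` generated by `x`, `y⁻¹`, `z`. -/
noncomputable def Uvee (F : Type*) [Field F] (q : F) : Subalgebra F (Usl2 F q) :=
  Algebra.adjoin F {ux F q, uy' F q, uz F q}


/-- Generators for the algebra `Ū_q`: `x`, `ȳ`, `z`. -/
inductive BGen : Type
  | x | y | z

/-- The defining relations of `Ū_q`:
`(q ȳ x − q⁻¹ x ȳ)/(q − q⁻¹) = ȳ²`, `(q z ȳ − q⁻¹ ȳ z)/(q − q⁻¹) = ȳ²`,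
`(q z x − q⁻¹ x z)/(q − q⁻¹) = 1`. -/
inductive BRel (F : Type*) [Field F] (q : F) :
    FreeAlgebra F BGen → FreeAlgebra F BGen → Prop
  | yx : BRel F q
      (q • (FreeAlgebra.ι F BGen.y * FreeAlgebra.ι F BGen.x)
        - q⁻¹ • (FreeAlgebra.ι F BGen.x * FreeAlgebra.ι F BGen.y))
      ((q - q⁻¹) • (FreeAlgebra.ι F BGen.y * FreeAlgebra.ι F BGen.y))
  | zy : BRel F q
      (q • (FreeAlgebra.ι F BGen.z * FreeAlgebra.ι F BGen.y)
        - q⁻¹ • (FreeAlgebra.ι F BGen.y * FreeAlgebra.ι F BGen.z))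
      ((q - q⁻¹) • (FreeAlgebra.ι F BGen.y * FreeAlgebra.ι F BGen.y))
  | zx : BRel F q
      (q • (FreeAlgebra.ι F BGen.z * FreeAlgebra.ι F BGen.x)
        - q⁻¹ • (FreeAlgebra.ι F BGen.x * FreeAlgebra.ι F BGen.z))
      ((q - q⁻¹) • (1 : FreeAlgebra F BGen))

/-- The algebra `Ū_q`. -/
abbrev Ubar (F : Type*) [Field F] (q : F) := RingQuot (BRel F q)

noncomputable def bx (F : Type*) [Field F] (q : F) : Ubar F q :=
  RingQuot.mkAlgHom F (BRel F q) (FreeAlgebra.ι F BGen.x)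

noncomputable def bybar (F : Type*) [Field F] (q : F) : Ubar F q :=
  RingQuot.mkAlgHom F (BRel F q) (FreeAlgebra.ι F BGen.y)

noncomputable def bz (F : Type*) [Field F] (q : F) : Ubar F q :=
  RingQuot.mkAlgHom F (BRel F q) (FreeAlgebra.ι F BGen.z)

section Helpers

variable {F : Type*} [Field F]

/-- From the relations of `Ū_q` to the q-commutation form. -/
theorem to_efk {A : Type*} [Ring A] [Algebra F A] (q : F) (hq0 : q ≠ 0) (x k z : A)
    (h1 : q • (k * x) - q⁻¹ • (x * k) = (q - q⁻¹) • (k * k))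
    (h2 : q • (z * k) - q⁻¹ • (k * z) = (q - q⁻¹) • (k * k))
    (h3 : q • (z * x) - q⁻¹ • (x * z) = (q - q⁻¹) • (1 : A)) :
    k * (x - k) = (q⁻¹ ^ 2) • ((x - k) * k) ∧
    (z - k) * k = (q⁻¹ ^ 2) • (k * (z - k)) ∧
    (z - k) * (x - k) = (q⁻¹ ^ 2) • ((x - k) * (z - k))
      + (1 - q⁻¹ ^ 2) • (1 - k * k) := by
  have e : ∀ u v w : A, q • u - q⁻¹ • v = (q - q⁻¹) • w →
      u = (q⁻¹ ^ 2) • v + (1 - q⁻¹ ^ 2) • w := by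
    intro u v w h
    have h' : u = q⁻¹ • (q⁻¹ • v + (q - q⁻¹) • w) := by
      rw [← h]
      simp [smul_smul, hq0]
    rw [h', smul_add, smul_smul, smul_smul]
    congr 2
    · ring
    · field_simp
  have e1 := e _ _ _ h1
  have e2 := e _ _ _ h2
  have e3 := e _ _ _ h3
  refine ⟨?_, ?_, ?_⟩
  · simp only [mul_sub, sub_mul, e1]; module
  · simp only [mul_sub, sub_mul, e2]; module
  · simp only [mul_sub, sub_mul, e1, e2, e3]; module

theorem fe_pow {A : Type*} [Ring A] [Algebra F A] (p : F) (e k f : A)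
    (h1 : k * e = p • (e * k))
    (h3 : f * e = p • (e * f) + (1 - p) • (1 - k * k)) (r : ℕ) :
    f * e ^ (r + 1) = p ^ (r + 1) • (e ^ (r + 1) * f) + (1 - p ^ (r + 1)) • e ^ r
      - (p ^ r * (1 - p ^ (r + 1))) • (e ^ r * (k * k)) := by
  have hk : k * k * e = (p ^ 2) • (e * (k * k)) := by
    rw [mul_assoc, h1, mul_smul_comm, ← mul_assoc, h1, smul_mul_assoc, smul_smul, mul_assoc, sq]
  induction r with
  | zero =>
    simp [h3]; module
  | succ r ih =>
    rw [pow_succ e (r + 1), ← mul_assoc, ih]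
    simp only [sub_mul, add_mul, smul_mul_assoc, mul_assoc, h3]
    rw [← mul_assoc k k e, hk]
    simp only [mul_add, mul_sub, mul_smul_comm, mul_one, ← mul_assoc, ← pow_succ]
    module

theorem ke_pow {A : Type*} [Ring A] [Algebra F A] (p : F) (e k : A)
    (h1 : k * e = p • (e * k)) (r : ℕ) :
    k * e ^ r = p ^ r • (e ^ r * k) := by
  induction r with
  | zero => simp
  | succ r ih =>
    rw [pow_succ, ← mul_assoc, ih, smul_mul_assoc, mul_assoc, h1, mul_smul_comm, smul_smul,
      mul_assoc, pow_succ]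

theorem fk_pow {A : Type*} [Ring A] [Algebra F A] (p : F) (k f : A)
    (h2 : f * k = p • (k * f)) (s : ℕ) :
    f * k ^ s = p ^ s • (k ^ s * f) := by
  induction s with
  | zero => simp
  | succ r ih =>
    rw [pow_succ, ← mul_assoc, ih, smul_mul_assoc, mul_assoc, h2, mul_smul_comm, smul_smul,
      mul_assoc, pow_succ]

/-- PBW monomials. -/
def mon {A : Type*} [Ring A] (e k f : A) (i : ℕ × ℕ × ℕ) : A :=
  e ^ i.1 * (k ^ i.2.1 * f ^ i.2.2)

theorem mon_mem {A : Type*} [Ring A] [Algebra F A] (e k f : A) (r s t : ℕ) :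
    e ^ r * (k ^ s * f ^ t) ∈ Submodule.span F (Set.range (mon e k f)) :=
  Submodule.subset_span ⟨(r, s, t), rfl⟩

theorem span_closed {A : Type*} [Ring A] [Algebra F A] (p p' : F) (hp : p' * p = 1) (e k f : A)
    (h1 : k * e = p • (e * k)) (h2 : f * k = p • (k * f))
    (h3 : f * e = p • (e * f) + (1 - p) • (1 - k * k))
    (m : A) (hm : m ∈ Submodule.span F (Set.range (mon e k f))) :
    e * m ∈ Submodule.span F (Set.range (mon e k f)) ∧
    k * m ∈ Submodule.span F (Set.range (mon e k f)) ∧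
    f * m ∈ Submodule.span F (Set.range (mon e k f)) := by
  induction hm using Submodule.span_induction with
  | zero => simp
  | add a b _ _ ha hb =>
    simp only [mul_add]
    exact ⟨add_mem ha.1 hb.1, add_mem ha.2.1 hb.2.1, add_mem ha.2.2 hb.2.2⟩
  | smul c a _ ha =>
    simp only [mul_smul_comm]
    exact ⟨Submodule.smul_mem _ _ ha.1, Submodule.smul_mem _ _ ha.2.1,
      Submodule.smul_mem _ _ ha.2.2⟩
  | mem a ha =>
    obtain ⟨⟨r, s, t⟩, rfl⟩ := ha
    have hkf : ∀ r s t : ℕ, e ^ r * (f * (k ^ s * f ^ t)) ∈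
        Submodule.span F (Set.range (mon e k f)) := by
      intro r s t
      rw [← mul_assoc f, fk_pow p k f h2, smul_mul_assoc, mul_smul_comm, mul_assoc, ← pow_succ']
      exact Submodule.smul_mem _ _ (mon_mem (F := F) e k f _ _ _)
    simp only [mon]
    refine ⟨?_, ?_, ?_⟩
    · rw [← mul_assoc, ← pow_succ']
      exact mon_mem (F := F) e k f _ _ _
    · rw [← mul_assoc, ke_pow p e k h1, smul_mul_assoc, mul_assoc, ← mul_assoc k, ← pow_succ']
      exact Submodule.smul_mem _ _ (mon_mem (F := F) e k f _ _ _)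
    · cases r with
      | zero => simpa using hkf 0 s t
      | succ r =>
        rw [← mul_assoc, fe_pow p e k f h1 h3]
        simp only [add_mul, sub_mul, smul_mul_assoc, mul_assoc]
        refine sub_mem (add_mem (Submodule.smul_mem _ _ (hkf _ _ _))
          (Submodule.smul_mem _ _ (mon_mem (F := F) e k f _ _ _))) (Submodule.smul_mem _ _ ?_)
        rw [← mul_assoc k (k ^ s), ← pow_succ', ← mul_assoc k, ← pow_succ']
        exact mon_mem (F := F) e k f _ _ _

/-- The representation space. -/
abbrev MM (F : Type*) [Field F] := (ℕ × ℤ × ℕ) →₀ F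

noncomputable def vb (F : Type*) [Field F] (r : ℕ) (s : ℤ) (t : ℕ) : MM F :=
  Finsupp.single (r, s, t) 1

noncomputable def mkEnd (g : ℕ → ℤ → ℕ → MM F) : Module.End F (MM F) :=
  Finsupp.linearCombination F (fun i : ℕ × ℤ × ℕ => g i.1 i.2.1 i.2.2)

theorem mkEnd_vb (g : ℕ → ℤ → ℕ → MM F) (r : ℕ) (s : ℤ) (t : ℕ) :
    mkEnd g (vb F r s t) = g r s t := by
  simp [mkEnd, vb]

theorem end_ext (S T : Module.End F (MM F))
    (h : ∀ r s t, S (vb F r s t) = T (vb F r s t)) : S = T := by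
  refine Finsupp.lhom_ext' fun i => LinearMap.ext_ring ?_
  exact h i.1 i.2.1 i.2.2

noncomputable def oE (F : Type*) [Field F] : Module.End F (MM F) :=
  mkEnd fun r s t => vb F (r + 1) s t

noncomputable def oK (p : F) : Module.End F (MM F) :=
  mkEnd fun r s t => p ^ r • vb F r (s + 1) t

noncomputable def oKi (p' : F) : Module.End F (MM F) :=
  mkEnd fun r s t => p' ^ r • vb F r (s - 1) t

noncomputable def oF (p p' : F) : Module.End F (MM F) :=
  mkEnd fun r s t => (p ^ r * p ^ s) • vb F r s (t + 1) + (1 - p ^ r) • vb F (r - 1) s t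
    - (p' * p ^ r * (1 - p ^ r)) • vb F (r - 1) (s + 2) t

theorem oK_oKi (p p' : F) (hp : p' * p = 1) : oK p * oKi p' = 1 := by
  refine end_ext _ _ fun r s t => ?_
  simp [oK, oKi, mkEnd_vb, smul_smul, ← mul_pow, hp]

theorem oKi_oK (p p' : F) (hp : p' * p = 1) : oKi p' * oK p = 1 := by
  refine end_ext _ _ fun r s t => ?_
  simp [oK, oKi, mkEnd_vb, smul_smul, ← mul_pow, mul_comm p p', hp]

theorem oK_oE (p : F) : oK p * oE F = p • (oE F * oK p) := by
  refine end_ext _ _ fun r s t => ?_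
  simp [oK, oE, mkEnd_vb, smul_smul, pow_succ']

theorem oF_oK (p p' : F) (hp : p' * p = 1) : oF p p' * oK p = p • (oK p * oF p p') := by
  have hp0 : p ≠ 0 := right_ne_zero_of_mul_eq_one hp
  refine end_ext _ _ fun r s t => ?_
  have h3 : s + 2 + 1 = s + 1 + 2 := by ring
  cases r with
  | zero =>
    simp [oK, oF, mkEnd_vb, smul_smul, zpow_add₀ hp0, mul_comm]
  | succ r =>
    simp [oK, oF, mkEnd_vb, zpow_add₀ hp0, h3]
    module

theorem oF_oE (p p' : F) (hp : p' * p = 1) :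
    oF p p' * oE F = p • (oE F * oF p p') + (1 - p) • (1 - oK p * oK p) := by
  have hp0 : p ≠ 0 := right_ne_zero_of_mul_eq_one hp
  have hp' : p' = p⁻¹ := eq_inv_of_mul_eq_one_left hp
  subst hp'
  refine end_ext _ _ fun r s t => ?_
  have h3 : s + 1 + 1 = s + 2 := by ring
  cases r with
  | zero =>
    simp [oK, oF, oE, mkEnd_vb, h3, hp0]
    module
  | succ r =>
    simp [oK, oF, oE, mkEnd_vb, h3, pow_succ]
    match_scalars <;> field_simp <;> ring

/-- From operators satisfying the `e,k,f` relations to the equitable relations. -/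
theorem from_efk {A : Type*} [Ring A] [Algebra F A] (q : F) (hq0 : q ≠ 0) (e k ki f : A)
    (hk : k * ki = 1) (hk' : ki * k = 1)
    (h1 : k * e = (q⁻¹ ^ 2) • (e * k)) (h2 : f * k = (q⁻¹ ^ 2) • (k * f))
    (h3 : f * e = (q⁻¹ ^ 2) • (e * f) + (1 - q⁻¹ ^ 2) • (1 - k * k)) :
    q • ((e + k) * ki) - q⁻¹ • (ki * (e + k)) = (q - q⁻¹) • (1 : A) ∧
    q • (ki * (f + k)) - q⁻¹ • ((f + k) * ki) = (q - q⁻¹) • (1 : A) ∧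
    q • ((f + k) * (e + k)) - q⁻¹ • ((e + k) * (f + k)) = (q - q⁻¹) • (1 : A) := by
  have a1 : e * ki = (q⁻¹ ^ 2) • (ki * e) := by
    calc e * ki = ki * (k * e) * ki := by rw [← mul_assoc, hk', one_mul]
      _ = _ := by rw [h1, mul_smul_comm, smul_mul_assoc, mul_assoc, mul_assoc, hk, mul_one]
  have a2 : ki * f = (q⁻¹ ^ 2) • (f * ki) := by
    calc ki * f = ki * (f * k) * ki := by rw [mul_assoc, mul_assoc, hk, mul_one]
      _ = _ := by rw [h2, mul_smul_comm, smul_mul_assoc, ← mul_assoc, hk', one_mul]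
  refine ⟨?_, ?_, ?_⟩
  · simp only [mul_add, add_mul, a1, hk, hk']
    match_scalars <;> field_simp <;> ring
  · simp only [mul_add, add_mul, a2, hk, hk']
    match_scalars <;> field_simp <;> ring
  · simp only [mul_add, add_mul, h1, h2, h3]
    match_scalars <;> field_simp <;> ring

/-- Relations of `Ū_q` hold in `U_q(sl2)`. -/
theorem to_bar {A : Type*} [Ring A] [Algebra F A] (q : F) (x y k z : A)
    (hk : y * k = 1) (hk' : k * y = 1)
    (h1 : q • (x * y) - q⁻¹ • (y * x) = (q - q⁻¹) • (1 : A))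
    (h2 : q • (y * z) - q⁻¹ • (z * y) = (q - q⁻¹) • (1 : A)) :
    q • (k * x) - q⁻¹ • (x * k) = (q - q⁻¹) • (k * k) ∧
    q • (z * k) - q⁻¹ • (k * z) = (q - q⁻¹) • (k * k) := by
  constructor
  · have := congrArg (fun u => k * u * k) h1
    simp only [mul_sub, sub_mul, mul_smul_comm, smul_mul_assoc, mul_one] at this
    rwa [← mul_assoc k y x, hk', one_mul, mul_assoc k, mul_assoc x, hk, mul_one] at this
  · have := congrArg (fun u => k * u * k) h2
    simp only [mul_sub, sub_mul, mul_smul_comm, smul_mul_assoc, mul_one] at this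
    rwa [← mul_assoc k y z, hk', one_mul, mul_assoc k, mul_assoc z, hk, mul_one] at this

noncomputable def repGen (q : F) : EqGen → Module.End F (MM F)
  | .x => oE F + oK (q⁻¹ ^ 2)
  | .y => oKi (q ^ 2)
  | .y' => oK (q⁻¹ ^ 2)
  | .z => oF (q⁻¹ ^ 2) (q ^ 2) + oK (q⁻¹ ^ 2)

theorem qq (q : F) (hq0 : q ≠ 0) : q ^ 2 * q⁻¹ ^ 2 = 1 := by
  rw [← mul_pow, mul_inv_cancel₀ hq0, one_pow]

noncomputable def rep (q : F) (hq0 : q ≠ 0) : Usl2 F q →ₐ[F] Module.End F (MM F) :=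
  RingQuot.liftAlgHom F ⟨FreeAlgebra.lift F (repGen q), by
    have hp := qq q hq0
    obtain ⟨g1, g2, g3⟩ := from_efk (A := Module.End F (MM F)) q hq0 (oE F) (oK (q⁻¹ ^ 2))
      (oKi (q ^ 2)) (oF (q⁻¹ ^ 2) (q ^ 2)) (oK_oKi _ _ hp) (oKi_oK _ _ hp)
      (oK_oE (q⁻¹ ^ 2)) (oF_oK _ _ hp) (oF_oE _ _ hp)
    intro a b h
    cases h <;> simp only [map_sub, map_smul, map_mul, map_one, FreeAlgebra.lift_ι_apply, repGen]
    · exact oKi_oK _ _ hp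
    · exact oK_oKi _ _ hp
    · exact g1
    · exact g2
    · exact g3⟩

theorem rep_ux (q : F) (hq0 : q ≠ 0) : rep q hq0 (ux F q) = oE F + oK (q⁻¹ ^ 2) := by
  simp [rep, ux, repGen]

theorem rep_uy' (q : F) (hq0 : q ≠ 0) : rep q hq0 (uy' F q) = oK (q⁻¹ ^ 2) := by
  simp [rep, uy', repGen]

theorem rep_uz (q : F) (hq0 : q ≠ 0) :
    rep q hq0 (uz F q) = oF (q⁻¹ ^ 2) (q ^ 2) + oK (q⁻¹ ^ 2) := by
  simp [rep, uz, repGen]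

theorem mon_act (p p' : F) (i : ℕ × ℕ × ℕ) :
    mon (oE F) (oK p) (oF p p') i (vb F 0 0 0) = vb F i.1 i.2.1 i.2.2 := by
  obtain ⟨r, s, t⟩ := i
  have hF : ∀ t : ℕ, (oF p p' ^ t) (vb F 0 0 0) = vb F 0 0 t := by
    intro t
    induction t with
    | zero => simp
    | succ t ih => rw [pow_succ', Module.End.mul_apply, ih]; simp [oF, mkEnd_vb]
  have hK : ∀ s t : ℕ, (oK p ^ s) (vb F 0 0 t) = vb F 0 s t := by
    intro s t
    induction s with
    | zero => simp
    | succ s ih => rw [pow_succ', Module.End.mul_apply, ih]; simp [oK, mkEnd_vb]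
  have hE : ∀ (r : ℕ) (s : ℤ) (t : ℕ), (oE F ^ r) (vb F 0 s t) = vb F r s t := by
    intro r s t
    induction r with
    | zero => simp
    | succ r ih => rw [pow_succ', Module.End.mul_apply, ih]; simp [oE, mkEnd_vb]
  simp only [mon, Module.End.mul_apply, hF, hK, hE]

noncomputable def iotaGen (q : F) : BGen → Usl2 F q
  | .x => ux F q
  | .y => uy' F q
  | .z => uz F q

theorem u_rels (q : F) :
    q • (uy' F q * ux F q) - q⁻¹ • (ux F q * uy' F q) = (q - q⁻¹) • (uy' F q * uy' F q) ∧
    q • (uz F q * uy' F q) - q⁻¹ • (uy' F q * uz F q) = (q - q⁻¹) • (uy' F q * uy' F q) ∧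
    q • (uz F q * ux F q) - q⁻¹ • (ux F q * uz F q) = (q - q⁻¹) • (1 : Usl2 F q) := by
  have r1 := RingQuot.mkAlgHom_rel F (EqRel.yy' (F := F) (q := q))
  have r2 := RingQuot.mkAlgHom_rel F (EqRel.y'y (F := F) (q := q))
  have r3 := RingQuot.mkAlgHom_rel F (EqRel.xy (F := F) (q := q))
  have r4 := RingQuot.mkAlgHom_rel F (EqRel.yz (F := F) (q := q))
  have r5 := RingQuot.mkAlgHom_rel F (EqRel.zx (F := F) (q := q))
  simp only [map_sub, map_smul, map_mul, map_one] at r1 r2 r3 r4 r5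
  obtain ⟨a, b⟩ := to_bar q _ _ _ _ r1 r2 r3 r4
  exact ⟨a, b, r5⟩

theorem b_rels (q : F) :
    q • (bybar F q * bx F q) - q⁻¹ • (bx F q * bybar F q)
      = (q - q⁻¹) • (bybar F q * bybar F q) ∧
    q • (bz F q * bybar F q) - q⁻¹ • (bybar F q * bz F q)
      = (q - q⁻¹) • (bybar F q * bybar F q) ∧
    q • (bz F q * bx F q) - q⁻¹ • (bx F q * bz F q) = (q - q⁻¹) • (1 : Ubar F q) := by
  have r3 := RingQuot.mkAlgHom_rel F (BRel.yx (F := F) (q := q))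
  have r4 := RingQuot.mkAlgHom_rel F (BRel.zy (F := F) (q := q))
  have r5 := RingQuot.mkAlgHom_rel F (BRel.zx (F := F) (q := q))
  simp only [map_sub, map_smul, map_mul, map_one] at r3 r4 r5
  exact ⟨r3, r4, r5⟩

noncomputable def iota (q : F) : Ubar F q →ₐ[F] Usl2 F q :=
  RingQuot.liftAlgHom F ⟨FreeAlgebra.lift F (iotaGen q), by
    obtain ⟨g1, g2, g3⟩ := u_rels q
    intro a b h
    cases h <;> simp only [map_sub, map_smul, map_mul, map_one, FreeAlgebra.lift_ι_apply, iotaGen]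
    · exact g1
    · exact g2
    · exact g3⟩

theorem iota_bx (q : F) : iota q (bx F q) = ux F q := by
  simp [iota, bx, iotaGen]

theorem iota_by (q : F) : iota q (bybar F q) = uy' F q := by
  simp [iota, bybar, iotaGen]

theorem iota_bz (q : F) : iota q (bz F q) = uz F q := by
  simp [iota, bz, iotaGen]

theorem bar_span (q : F) (hq0 : q ≠ 0) (a : Ubar F q) :
    a ∈ Submodule.span F
      (Set.range (mon (bx F q - bybar F q) (bybar F q) (bz F q - bybar F q))) := by
  obtain ⟨g1, g2, g3⟩ := b_rels q
  obtain ⟨h1, h2, h3⟩ := to_efk q hq0 _ _ _ g1 g2 g3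
  have hc := span_closed (q⁻¹ ^ 2) (q ^ 2) (qq q hq0) _ _ _ h1 h2 h3
  set S := Submodule.span F
      (Set.range (mon (bx F q - bybar F q) (bybar F q) (bz F q - bybar F q))) with hS
  have key : ∀ w : FreeAlgebra F BGen, ∀ m ∈ S, RingQuot.mkAlgHom F (BRel F q) w * m ∈ S := by
    intro w
    induction w using FreeAlgebra.induction with
    | grade0 c =>
      intro m hm
      rw [AlgHom.commutes, ← Algebra.smul_def]
      exact S.smul_mem _ hm
    | grade1 g =>
      intro m hm
      obtain ⟨c1, c2, c3⟩ := hc m hm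
      cases g with
      | x =>
        have := add_mem c1 c2
        rwa [← add_mul, sub_add_cancel] at this
      | y => exact c2
      | z =>
        have := add_mem c3 c2
        rwa [← add_mul, sub_add_cancel] at this
    | mul u v hu hv =>
      intro m hm
      rw [map_mul, mul_assoc]
      exact hu _ (hv _ hm)
    | add u v hu hv =>
      intro m hm
      rw [map_add, add_mul]
      exact add_mem (hu _ hm) (hv _ hm)
  obtain ⟨w, rfl⟩ := RingQuot.mkAlgHom_surjective F (BRel F q) a
  have h1S : (1 : Ubar F q) ∈ S := Submodule.subset_span ⟨(0, 0, 0), by simp [mon]⟩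
  simpa using key w 1 h1S

theorem map_mon {A B : Type*} [Ring A] [Ring B] [Algebra F A] [Algebra F B] (φ : A →ₐ[F] B)
    (e k f : A) (i : ℕ × ℕ × ℕ) : φ (mon e k f i) = mon (φ e) (φ k) (φ f) i := by
  simp [mon]

theorem iota_inj (q : F) (hq0 : q ≠ 0) : Function.Injective (iota q) := by
  rw [injective_iff_map_eq_zero]
  intro a ha
  obtain ⟨c, rfl⟩ := (Finsupp.mem_span_range_iff_exists_finsupp).1 (bar_span q hq0 a)
  set e := bx F q - bybar F q with he
  set f := bz F q - bybar F q with hf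
  let Φ : Ubar F q →ₐ[F] Module.End F (MM F) := (rep q hq0).comp (iota q)
  have hΦ : ∀ i, Φ (mon e (bybar F q) f i) (vb F 0 0 0) = vb F i.1 i.2.1 i.2.2 := by
    intro i
    have h0 := map_mon (F := F) (A := Ubar F q) (B := Module.End F (MM F)) Φ e (bybar F q) f i
    have h1 : Φ e = oE F := by
      simp [Φ, he, iota_bx, iota_by, rep_ux, rep_uy']
      exact add_sub_cancel_right (G := Module.End F (MM F)) _ _
    have h2 : Φ (bybar F q) = oK (q⁻¹ ^ 2) := by
      simp only [Φ, AlgHom.comp_apply, iota_by, rep_uy']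
    have h3 : Φ f = oF (q⁻¹ ^ 2) (q ^ 2) := by
      simp [Φ, hf, iota_bz, iota_by, rep_uz, rep_uy']
      exact add_sub_cancel_right (G := Module.End F (MM F)) _ _
    rw [h1, h2, h3] at h0
    exact (congrArg (fun T : Module.End F (MM F) => T (vb F 0 0 0)) h0).trans (mon_act _ _ i)
  have hz : Φ (c.sum fun i a => a • mon e (bybar F q) f i) (vb F 0 0 0) = 0 := by
    simp only [Φ, AlgHom.comp_apply, ha, map_zero, LinearMap.zero_apply]
  let emb : ℕ × ℕ × ℕ → ℕ × ℤ × ℕ := fun i => (i.1, (i.2.1 : ℤ), i.2.2)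
  have hemb : Function.Injective emb := by
    rintro ⟨a, b, d⟩ ⟨a', b', d'⟩ h
    simpa [emb] using h
  have hm : Finsupp.mapDomain emb c = 0 := by
    rw [← hz, map_finsuppSum, Finsupp.sum, LinearMap.sum_apply, Finsupp.mapDomain, Finsupp.sum]
    refine Finset.sum_congr rfl fun i _ => ?_
    rw [map_smul, LinearMap.smul_apply, hΦ]
    simp [vb, emb]
  have hc : c = 0 := by
    apply Finsupp.mapDomain_injective hemb
    rw [hm, Finsupp.mapDomain_zero]
  rw [hc, Finsupp.sum_zero_index]

theorem bar_adjoin (q : F) : Algebra.adjoin F {bx F q, bybar F q, bz F q} = ⊤ := by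
  rw [eq_top_iff]
  rintro a -
  obtain ⟨w, rfl⟩ := RingQuot.mkAlgHom_surjective F (BRel F q) a
  induction w using FreeAlgebra.induction with
  | grade0 c => rw [AlgHom.commutes]; exact Subalgebra.algebraMap_mem _ _
  | grade1 g =>
    apply Algebra.subset_adjoin
    cases g
    · exact Or.inl rfl
    · exact Or.inr (Or.inl rfl)
    · exact Or.inr (Or.inr rfl)
  | mul u v hu hv => rw [map_mul]; exact mul_mem hu hv
  | add u v hu hv => rw [map_add]; exact add_mem hu hv

end Helpers

/-- **Theorem 10.14.** The algebra homomorphism `ι : Ū_q → U_q(sl2)` sending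
`x ↦ x`, `ȳ ↦ y⁻¹`, `z ↦ z` is an isomorphism of `Ū_q` onto the subalgebra `U_q^∨`;
in particular `U_q^∨` has a presentation by generators `x, y⁻¹, z` and relations
`(q y⁻¹ x − q⁻¹ x y⁻¹)/(q − q⁻¹) = y⁻²`, `(q z y⁻¹ − q⁻¹ y⁻¹ z)/(q − q⁻¹) = y⁻²`,
`(q z x − q⁻¹ x z)/(q − q⁻¹) = 1`. -/
theorem statement2 (F : Type*) [Field F] (q : F) (hq0 : q ≠ 0) (hq4 : q ^ 4 ≠ 1) :
    ∃ ι : Ubar F q →ₐ[F] Usl2 F q,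
      ι (bx F q) = ux F q ∧
      ι (bybar F q) = uy' F q ∧
      ι (bz F q) = uz F q ∧
      Function.Injective ι ∧
      ι.range = Uvee F q := by
  refine ⟨iota q, iota_bx q, iota_by q, iota_bz q, iota_inj q hq0, ?_⟩
  rw [← Algebra.map_top, ← bar_adjoin, AlgHom.map_adjoin, Uvee]
  simp only [Set.image_insert_eq, Set.image_singleton, iota_bx, iota_by, iota_bz]

end Paper
end

section
/- The 𝔽-algebra U_q^∨ has a presentation by generators z, Z, A and relations (qzA − q⁻¹Az)/(q − q⁻¹) = az² + a⁻¹, (qZA − q⁻¹AZ)/(q − q⁻¹) = a⁻¹Z² + a, and az² − ((a⁻¹q − aq⁻¹)/(q − q⁻¹))zZ − ((aq − a⁻¹q⁻¹)/(q − q⁻¹))Zz + a⁻¹Z² = 0. Precisely, there is an 𝔽-algebra isomorphism from the algebra with this presentation to U_q^∨ (presented by generators x, y⁻¹, z with relations (q y⁻¹ x − q⁻¹ x y⁻¹)/(q − q⁻¹) = y⁻², (q z y⁻¹ − q⁻¹ y⁻¹ z)/(q − q⁻¹) = y⁻², (q z x − q⁻¹ x z)/(q − q⁻¹) = 1) sending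 z ↦ z, Z ↦ a²z + (1 − a²)y⁻¹, A ↦ a⁻¹x + az, whose inverse sends x ↦ aA − a²z, y⁻¹ ↦ (az − a⁻¹Z)/(a − a⁻¹), z ↦ z. -/
namespace Paper

/-- Generators `z`, `Z`, `A`. -/
inductive QGen : Type
  | z | Z | A

/-- The defining relations among `z`, `Z`, `A`:
`(qzA − q⁻¹Az)/(q − q⁻¹) = az² + a⁻¹`, `(qZA − q⁻¹AZ)/(q − q⁻¹) = a⁻¹Z² + a`,
`az² − ((a⁻¹q − aq⁻¹)/(q − q⁻¹))zZ − ((aq − a⁻¹q⁻¹)/(q − q⁻¹))Zz + a⁻¹Z² = 0`. -/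
inductive QRel (F : Type*) [Field F] (q a : F) :
    FreeAlgebra F QGen → FreeAlgebra F QGen → Prop
  | zA : QRel F q a
      (q • (FreeAlgebra.ι F QGen.z * FreeAlgebra.ι F QGen.A)
        - q⁻¹ • (FreeAlgebra.ι F QGen.A * FreeAlgebra.ι F QGen.z))
      ((q - q⁻¹) • (a • (FreeAlgebra.ι F QGen.z * FreeAlgebra.ι F QGen.z)
        + a⁻¹ • (1 : FreeAlgebra F QGen)))
  | ZA : QRel F q a
      (q • (FreeAlgebra.ι F QGen.Z * FreeAlgebra.ι F QGen.A)
        - q⁻¹ • (FreeAlgebra.ι F QGen.A * FreeAlgebra.ι F QGen.Z))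
      ((q - q⁻¹) • (a⁻¹ • (FreeAlgebra.ι F QGen.Z * FreeAlgebra.ι F QGen.Z)
        + a • (1 : FreeAlgebra F QGen)))
  | zZ : QRel F q a
      (a • (FreeAlgebra.ι F QGen.z * FreeAlgebra.ι F QGen.z)
        - ((a⁻¹ * q - a * q⁻¹) / (q - q⁻¹)) •
            (FreeAlgebra.ι F QGen.z * FreeAlgebra.ι F QGen.Z)
        - ((a * q - a⁻¹ * q⁻¹) / (q - q⁻¹)) •
            (FreeAlgebra.ι F QGen.Z * FreeAlgebra.ι F QGen.z)
        + a⁻¹ • (FreeAlgebra.ι F QGen.Z * FreeAlgebra.ι F QGen.Z))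
      0

/-- The algebra presented by generators `z, Z, A` and the above relations. -/
abbrev UQ (F : Type*) [Field F] (q a : F) := RingQuot (QRel F q a)

noncomputable def qz (F : Type*) [Field F] (q a : F) : UQ F q a :=
  RingQuot.mkAlgHom F (QRel F q a) (FreeAlgebra.ι F QGen.z)

noncomputable def qZ (F : Type*) [Field F] (q a : F) : UQ F q a :=
  RingQuot.mkAlgHom F (QRel F q a) (FreeAlgebra.ι F QGen.Z)

noncomputable def qA (F : Type*) [Field F] (q a : F) : UQ F q a :=
  RingQuot.mkAlgHom F (QRel F q a) (FreeAlgebra.ι F QGen.A)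

section helpers

variable {F : Type*} [Field F] {R : Type*} [Ring R] [Algebra F R]

theorem aux_ZA {q a : F} (hq0 : q ≠ 0) (ha0 : a ≠ 0) {x y z : R}
    (h1 : q • (y * x) - q⁻¹ • (x * y) = (q - q⁻¹) • (y * y))
    (h2 : q • (z * y) - q⁻¹ • (y * z) = (q - q⁻¹) • (y * y))
    (h3 : q • (z * x) - q⁻¹ • (x * z) = (q - q⁻¹) • (1 : R)) :
    q • ((a ^ 2 • z + (1 - a ^ 2) • y) * (a⁻¹ • x + a • z))
      - q⁻¹ • ((a⁻¹ • x + a • z) * (a ^ 2 • z + (1 - a ^ 2) • y))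
    = (q - q⁻¹) • (a⁻¹ • ((a ^ 2 • z + (1 - a ^ 2) • y) * (a ^ 2 • z + (1 - a ^ 2) • y))
        + a • (1 : R)) := by
  simp only [mul_add, add_mul, smul_mul_assoc, mul_smul_comm]
  linear_combination (norm := skip)
    ((1 - a ^ 2) * a⁻¹) • h1 - ((1 - a ^ 2) * a) • h2 + a • h3
  match_scalars <;> field_simp <;> ring

theorem aux_zA {q a : F} (hq0 : q ≠ 0) (ha0 : a ≠ 0) {x z : R}
    (h3 : q • (z * x) - q⁻¹ • (x * z) = (q - q⁻¹) • (1 : R)) :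
    q • (z * (a⁻¹ • x + a • z)) - q⁻¹ • ((a⁻¹ • x + a • z) * z)
    = (q - q⁻¹) • (a • (z * z) + a⁻¹ • (1 : R)) := by
  simp only [mul_add, add_mul, smul_mul_assoc, mul_smul_comm]
  linear_combination (norm := skip) a⁻¹ • h3
  match_scalars <;> field_simp <;> ring

theorem aux_zZ {q a : F} (hq0 : q ≠ 0) (hq : q ^ 2 - 1 ≠ 0) (ha0 : a ≠ 0) {y z : R}
    (h2 : q • (z * y) - q⁻¹ • (y * z) = (q - q⁻¹) • (y * y)) :
    a • (z * z) - ((a⁻¹ * q - a * q⁻¹) / (q - q⁻¹)) • (z * (a ^ 2 • z + (1 - a ^ 2) • y))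
      - ((a * q - a⁻¹ * q⁻¹) / (q - q⁻¹)) • ((a ^ 2 • z + (1 - a ^ 2) • y) * z)
      + a⁻¹ • ((a ^ 2 • z + (1 - a ^ 2) • y) * (a ^ 2 • z + (1 - a ^ 2) • y)) = 0 := by
  simp only [mul_add, add_mul, smul_mul_assoc, mul_smul_comm]
  linear_combination (norm := skip)
    (-((1 - a ^ 2) ^ 2 * a⁻¹ / (q - q⁻¹))) • h2
  match_scalars <;> field_simp <;> ring

theorem aux_zx {q a : F} (hq0 : q ≠ 0) (ha0 : a ≠ 0) {z A : R}
    (h1 : q • (z * A) - q⁻¹ • (A * z) = (q - q⁻¹) • (a • (z * z) + a⁻¹ • (1 : R))) :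
    q • (z * (a • A - a ^ 2 • z)) - q⁻¹ • ((a • A - a ^ 2 • z) * z)
    = (q - q⁻¹) • (1 : R) := by
  simp only [mul_sub, sub_mul, smul_mul_assoc, mul_smul_comm]
  linear_combination (norm := skip) a • h1
  match_scalars <;> field_simp <;> ring

theorem aux_zy {q a : F} (hq0 : q ≠ 0) (hq : q ^ 2 - 1 ≠ 0) (ha0 : a ≠ 0)
    (ha : a ^ 2 - 1 ≠ 0) {z Z : R}
    (h3 : a • (z * z) - ((a⁻¹ * q - a * q⁻¹) / (q - q⁻¹)) • (z * Z)
      - ((a * q - a⁻¹ * q⁻¹) / (q - q⁻¹)) • (Z * z) + a⁻¹ • (Z * Z) = 0) :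
    q • (z * ((a - a⁻¹)⁻¹ • (a • z - a⁻¹ • Z)))
      - q⁻¹ • (((a - a⁻¹)⁻¹ • (a • z - a⁻¹ • Z)) * z)
    = (q - q⁻¹) • (((a - a⁻¹)⁻¹ • (a • z - a⁻¹ • Z)) * ((a - a⁻¹)⁻¹ • (a • z - a⁻¹ • Z))) := by
  simp only [mul_sub, sub_mul, smul_mul_assoc, mul_smul_comm]
  linear_combination (norm := skip) (-((q - q⁻¹) * a / (a ^ 2 - 1) ^ 2)) • h3
  match_scalars <;> field_simp <;> ring

theorem aux_yx {q a : F} (hq0 : q ≠ 0) (hq : q ^ 2 - 1 ≠ 0) (ha0 : a ≠ 0)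
    (ha : a ^ 2 - 1 ≠ 0) {z Z A : R}
    (h1 : q • (z * A) - q⁻¹ • (A * z) = (q - q⁻¹) • (a • (z * z) + a⁻¹ • (1 : R)))
    (h2 : q • (Z * A) - q⁻¹ • (A * Z) = (q - q⁻¹) • (a⁻¹ • (Z * Z) + a • (1 : R)))
    (h3 : a • (z * z) - ((a⁻¹ * q - a * q⁻¹) / (q - q⁻¹)) • (z * Z)
      - ((a * q - a⁻¹ * q⁻¹) / (q - q⁻¹)) • (Z * z) + a⁻¹ • (Z * Z) = 0) :
    q • (((a - a⁻¹)⁻¹ • (a • z - a⁻¹ • Z)) * (a • A - a ^ 2 • z))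
      - q⁻¹ • ((a • A - a ^ 2 • z) * ((a - a⁻¹)⁻¹ • (a • z - a⁻¹ • Z)))
    = (q - q⁻¹) • (((a - a⁻¹)⁻¹ • (a • z - a⁻¹ • Z)) * ((a - a⁻¹)⁻¹ • (a • z - a⁻¹ • Z))) := by
  simp only [mul_sub, sub_mul, smul_mul_assoc, mul_smul_comm, smul_sub]
  linear_combination (norm := skip) ((a - a⁻¹)⁻¹ * a ^ 2) • h1 - (a - a⁻¹)⁻¹ • h2
    - ((q - q⁻¹) * a ^ 3 / (a ^ 2 - 1) ^ 2) • h3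
  match_scalars <;> field_simp <;> ring

end helpers

section maps

variable (F : Type*) [Field F] (q a : F)

theorem B_yx : q • (bybar F q * bx F q) - q⁻¹ • (bx F q * bybar F q)
    = (q - q⁻¹) • (bybar F q * bybar F q) := by
  simpa [bx, bybar] using RingQuot.mkAlgHom_rel F (BRel.yx (F := F) (q := q))

theorem B_zy : q • (bz F q * bybar F q) - q⁻¹ • (bybar F q * bz F q)
    = (q - q⁻¹) • (bybar F q * bybar F q) := by
  simpa [bz, bybar] using RingQuot.mkAlgHom_rel F (BRel.zy (F := F) (q := q))

theorem B_zx : q • (bz F q * bx F q) - q⁻¹ • (bx F q * bz F q)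
    = (q - q⁻¹) • (1 : Ubar F q) := by
  simpa only [bz, bx, map_sub, map_smul, map_mul, map_one]
    using RingQuot.mkAlgHom_rel F (BRel.zx (F := F) (q := q))

theorem Q_zA : q • (qz F q a * qA F q a) - q⁻¹ • (qA F q a * qz F q a)
    = (q - q⁻¹) • (a • (qz F q a * qz F q a) + a⁻¹ • (1 : UQ F q a)) := by
  simpa only [qz, qA, map_add, map_sub, map_smul, map_mul, map_one]
    using RingQuot.mkAlgHom_rel F (QRel.zA (F := F) (q := q) (a := a))

theorem Q_ZA : q • (qZ F q a * qA F q a) - q⁻¹ • (qA F q a * qZ F q a)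
    = (q - q⁻¹) • (a⁻¹ • (qZ F q a * qZ F q a) + a • (1 : UQ F q a)) := by
  simpa only [qZ, qA, map_add, map_sub, map_smul, map_mul, map_one]
    using RingQuot.mkAlgHom_rel F (QRel.ZA (F := F) (q := q) (a := a))

theorem Q_zZ : a • (qz F q a * qz F q a)
      - ((a⁻¹ * q - a * q⁻¹) / (q - q⁻¹)) • (qz F q a * qZ F q a)
      - ((a * q - a⁻¹ * q⁻¹) / (q - q⁻¹)) • (qZ F q a * qz F q a)
      + a⁻¹ • (qZ F q a * qZ F q a) = 0 := by
  simpa only [qz, qZ, map_add, map_sub, map_smul, map_mul, map_zero]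
    using RingQuot.mkAlgHom_rel F (QRel.zZ (F := F) (q := q) (a := a))

/-- Images of the generators `z, Z, A`. -/
noncomputable def fwdGen : QGen → Ubar F q
  | .z => bz F q
  | .Z => a ^ 2 • bz F q + (1 - a ^ 2) • bybar F q
  | .A => a⁻¹ • bx F q + a • bz F q

/-- Images of the generators `x, ȳ, z`. -/
noncomputable def bwdGen : BGen → UQ F q a
  | .x => a • qA F q a - a ^ 2 • qz F q a
  | .y => (a - a⁻¹)⁻¹ • (a • qz F q a - a⁻¹ • qZ F q a)
  | .z => qz F q a

theorem exists_fwd (hq0 : q ≠ 0) (hq : q ^ 2 - 1 ≠ 0) (ha0 : a ≠ 0) :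
    ∃ f : UQ F q a →ₐ[F] Ubar F q, f (qz F q a) = bz F q ∧
      f (qZ F q a) = a ^ 2 • bz F q + (1 - a ^ 2) • bybar F q ∧
      f (qA F q a) = a⁻¹ • bx F q + a • bz F q := by
  refine ⟨RingQuot.liftAlgHom F ⟨FreeAlgebra.lift F (fwdGen F q a), ?_⟩, ?_, ?_, ?_⟩
  · intro u v h
    cases h <;>
      simp only [map_add, map_sub, map_smul, map_mul, map_one, map_zero,
        FreeAlgebra.lift_ι_apply, fwdGen]
    · exact aux_zA hq0 ha0 (B_zx F q)
    · exact aux_ZA hq0 ha0 (B_yx F q) (B_zy F q) (B_zx F q)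
    · exact aux_zZ hq0 hq ha0 (B_zy F q)
  all_goals simp only [qz, qZ, qA, RingQuot.liftAlgHom_mkAlgHom_apply,
    FreeAlgebra.lift_ι_apply, fwdGen]

theorem exists_bwd (hq0 : q ≠ 0) (hq : q ^ 2 - 1 ≠ 0) (ha0 : a ≠ 0) (ha : a ^ 2 - 1 ≠ 0) :
    ∃ g : Ubar F q →ₐ[F] UQ F q a, g (bx F q) = a • qA F q a - a ^ 2 • qz F q a ∧
      g (bybar F q) = (a - a⁻¹)⁻¹ • (a • qz F q a - a⁻¹ • qZ F q a) ∧
      g (bz F q) = qz F q a := by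
  refine ⟨RingQuot.liftAlgHom F ⟨FreeAlgebra.lift F (bwdGen F q a), ?_⟩, ?_, ?_, ?_⟩
  · intro u v h
    cases h <;>
      simp only [map_sub, map_smul, map_mul, map_one, FreeAlgebra.lift_ι_apply, bwdGen]
    · exact aux_yx hq0 hq ha0 ha (Q_zA F q a) (Q_ZA F q a) (Q_zZ F q a)
    · exact aux_zy hq0 hq ha0 ha (Q_zZ F q a)
    · exact aux_zx hq0 ha0 (Q_zA F q a)
  all_goals simp only [bx, bybar, bz, RingQuot.liftAlgHom_mkAlgHom_apply,
    FreeAlgebra.lift_ι_apply, bwdGen]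

end maps

/-- **Theorem 10.22.** `U_q^∨` has a presentation by generators `z, Z, A` and relations
`(qzA − q⁻¹Az)/(q − q⁻¹) = az² + a⁻¹`, `(qZA − q⁻¹AZ)/(q − q⁻¹) = a⁻¹Z² + a`,
`az² − ((a⁻¹q − aq⁻¹)/(q − q⁻¹))zZ − ((aq − a⁻¹q⁻¹)/(q − q⁻¹))Zz + a⁻¹Z² = 0`;
here `U_q^∨` is taken in its presentation by generators `x, y⁻¹, z` (the algebra `Ū_q`).
The isomorphism sends `z ↦ z`, `Z ↦ a²z + (1 − a²)y⁻¹`, `A ↦ a⁻¹x + az`; its inverse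
sends `x ↦ aA − a²z`, `y⁻¹ ↦ (az − a⁻¹Z)/(a − a⁻¹)`, `z ↦ z`. -/
theorem statement5 (F : Type*) [Field F] (q : F) (hq0 : q ≠ 0) (hq4 : q ^ 4 ≠ 1)
    (a : F) (ha0 : a ≠ 0) (ha2 : a ^ 2 ≠ 1) :
    ∃ e : UQ F q a ≃ₐ[F] Ubar F q,
      e (qz F q a) = bz F q ∧
      e (qZ F q a) = a ^ 2 • bz F q + (1 - a ^ 2) • bybar F q ∧
      e (qA F q a) = a⁻¹ • bx F q + a • bz F q ∧
      e.symm (bx F q) = a • qA F q a - a ^ 2 • qz F q a ∧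
      e.symm (bybar F q) = (a - a⁻¹)⁻¹ • (a • qz F q a - a⁻¹ • qZ F q a) ∧
      e.symm (bz F q) = qz F q a := by
  have hq : q ^ 2 - 1 ≠ 0 := by
    intro h
    apply hq4
    linear_combination (q ^ 2 + 1) * h
  have ha : a ^ 2 - 1 ≠ 0 := sub_ne_zero.mpr ha2
  obtain ⟨f, f1, f2, f3⟩ := exists_fwd F q a hq0 hq ha0
  obtain ⟨g, g1, g2, g3⟩ := exists_bwd F q a hq0 hq ha0 ha
  have hfg : f.comp g = AlgHom.id F (Ubar F q) := by
    apply RingQuot.ringQuot_ext'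
    ext i
    cases i
    · change f (g (bx F q)) = bx F q
      simp only [g1, map_sub, map_smul, f1, f3]
      match_scalars <;> field_simp <;> ring
    · change f (g (bybar F q)) = bybar F q
      simp only [g2, map_sub, map_smul, f1, f2]
      match_scalars <;> field_simp <;> ring
    · change f (g (bz F q)) = bz F q
      rw [g3, f1]
  have hgf : g.comp f = AlgHom.id F (UQ F q a) := by
    apply RingQuot.ringQuot_ext'
    ext i
    cases i
    · change g (f (qz F q a)) = qz F q a
      rw [f1, g3]
    · change g (f (qZ F q a)) = qZ F q a
      simp only [f2, map_add, map_smul, g2, g3]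
      match_scalars <;> field_simp <;> ring
    · change g (f (qA F q a)) = qA F q a
      simp only [f3, map_add, map_smul, g1, g3]
      match_scalars <;> field_simp <;> ring
  exact ⟨AlgEquiv.ofAlgHom f g hfg hgf, f1, f2, f3, g1, g2, g3⟩

end Paper
end
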